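/- arXiv:1602.07500 — 4 statements merged into one kernel-verified Lean document; each statement's English description precedes it below -/
import Mathlib

section
/- Let i ≠ j be indices lying in the same block. Then the transposition permutation matrix T_{ij} (which interchanges the i-th and j-th standard basis vectors and fixes the others) is Θ-invariant, and there exists a Θ-invariant n × n matrix P over R[t], invertible in the ring of n × n matrices over R[t], such that P(0) is the diagonal matrix whose (i, i) entry is −1 and whose remaining diagonal entries are 1, and P(1) = T_{ij}. -/
open Matrix Polynomial

/-- The block sign matrix `J` over `R` with first `a` diagonal entries `1` and the
remaining `b` diagonal entries `-1`. -/
def blockJ (R : Type*) [CommRing R] (a b : ℕ) : Matrix (Fin (a + b)) (Fin (a + b)) R :=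
  Matrix.diagonal fun i => if (i : ℕ) < a then (1 : R) else -1

/-- The involution `Θ(M) = J * σ(M) * J` on `n × n` matrices, where `σ` is applied
entrywise. -/
def Theta {R : Type*} [CommRing R] (σ : R →+* R) (a b : ℕ)
    (M : Matrix (Fin (a + b)) (Fin (a + b)) R) : Matrix (Fin (a + b)) (Fin (a + b)) R :=
  blockJ R a b * M.map σ * blockJ R a b

/-- The transposition permutation matrix `T_{ij}`, interchanging the `i`-th and `j`-th
standard basis vectors and fixing the others. -/
def transpositionMatrix (R : Type*) [CommRing R] {n : ℕ} (i j : Fin n) :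
    Matrix (Fin n) (Fin n) R :=
  Matrix.of fun k l => if Equiv.swap i j k = l then (1 : R) else 0

theorem Theta_apply {R : Type*} [CommRing R] (σ : R →+* R) (a b : ℕ)
    (M : Matrix (Fin (a + b)) (Fin (a + b)) R) (k l : Fin (a + b)) :
    Theta σ a b M k l =
      (if (k : ℕ) < a then 1 else -1) * σ (M k l) * (if (l : ℕ) < a then 1 else -1) := by
  simp only [Theta, blockJ, Matrix.mul_diagonal, Matrix.diagonal_mul, Matrix.map_apply]

/-- A block-diagonal matrix whose entries are fixed by `σ` is `Θ`-invariant. -/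
theorem Theta_eq_self {R : Type*} [CommRing R] (σ : R →+* R) (a b : ℕ)
    (M : Matrix (Fin (a + b)) (Fin (a + b)) R) (hfix : ∀ k l, σ (M k l) = M k l)
    (hM : ∀ k l, M k l ≠ 0 → ((k : ℕ) < a ↔ (l : ℕ) < a)) : Theta σ a b M = M := by
  ext k l
  rw [Theta_apply, hfix]
  by_cases h : M k l = 0
  · simp [h]
  · have := hM k l h
    by_cases hl : (l : ℕ) < a <;> simp [this, hl]

/-- The identity matrix with its principal submatrix on `i, j` replaced by
`[p q; r s]`. -/
def planeMatrix {ι S : Type*} [DecidableEq ι] [CommRing S] (i j : ι) (p q r s : S) :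
    Matrix ι ι S :=
  Matrix.of fun k =>
    if k = i then Pi.single i p + Pi.single j q
    else if k = j then Pi.single i r + Pi.single j s
    else Pi.single k 1

theorem planeMatrix_map {ι S T : Type*} [DecidableEq ι] [CommRing S] [CommRing T]
    (f : S →+* T) (i j : ι) (p q r s : S) :
    (planeMatrix i j p q r s).map f = planeMatrix i j (f p) (f q) (f r) (f s) := by
  ext k l
  simp only [planeMatrix, Matrix.map_apply, Matrix.of_apply]
  split_ifs <;> simp only [Pi.add_apply, Pi.single_apply, map_add] <;> split_ifs <;> simp

theorem planeMatrix_mul_self {ι S : Type*} [Fintype ι] [DecidableEq ι] [CommRing S]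
    {i j : ι} (hij : i ≠ j) {p q r : S} (h : p * p + q * r = 1) :
    planeMatrix i j p q r (-p) * planeMatrix i j p q r (-p) = 1 := by
  have hi : planeMatrix i j p q r (-p) i = Pi.single i p + Pi.single j q :=
    if_pos rfl
  have hj : planeMatrix i j p q r (-p) j = Pi.single i r + Pi.single j (-p) :=
    (if_neg hij.symm).trans (if_pos rfl)
  ext k l
  rw [Matrix.mul_apply_eq_vecMul]
  by_cases hki : k = i
  · subst hki
    rw [hi, Matrix.add_vecMul, Matrix.single_vecMul, Matrix.single_vecMul]
    simp only [Matrix.row, hi, hj, Pi.add_apply, Pi.smul_apply, Pi.single_apply,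
      Matrix.one_apply, smul_eq_mul]
    grind
  by_cases hkj : k = j
  · subst hkj
    rw [hj, Matrix.add_vecMul, Matrix.single_vecMul, Matrix.single_vecMul]
    simp only [Matrix.row, hi, hj, Pi.add_apply, Pi.smul_apply, Pi.single_apply,
      Matrix.one_apply, smul_eq_mul]
    grind
  have hk : planeMatrix i j p q r (-p) k = Pi.single k 1 :=
    (if_neg hki).trans (if_neg hkj)
  rw [hk, Matrix.single_vecMul]
  simp only [Matrix.row, hk, Pi.smul_apply, Pi.single_apply, Matrix.one_apply, smul_eq_mul]
  grind

/-- If `i ≠ j` lie in the same block then `T_{ij}` is `Θ`-invariant and there is a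
`Θ`-invariant invertible matrix `P` over `R[t]` with `P(0) = diag(1,…,-1,…,1)`
(`-1` in position `i`) and `P(1) = T_{ij}`. -/
theorem stmt2 {R : Type*} [CommRing R] (σ : R →+* R) (hσ : Function.Involutive σ)
    (a b : ℕ) (i j : Fin (a + b)) (hij : i ≠ j)
    (hblock : ((i : ℕ) < a ↔ (j : ℕ) < a)) :
    Theta σ a b (transpositionMatrix R i j) = transpositionMatrix R i j ∧
    ∃ P : Matrix (Fin (a + b)) (Fin (a + b)) (Polynomial R),
      Theta (Polynomial.mapRingHom σ) a b P = P ∧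
      IsUnit P ∧
      P.map (Polynomial.evalRingHom (0 : R)) =
        Matrix.diagonal (fun k => if k = i then (-1 : R) else 1) ∧
      P.map (Polynomial.evalRingHom (1 : R)) = transpositionMatrix R i j := by
  have hT : transpositionMatrix R i j = planeMatrix i j 0 1 1 0 := by
    ext k l
    simp only [transpositionMatrix, planeMatrix, Matrix.of_apply, Equiv.swap_apply_def]
    split_ifs <;> simp_all [eq_comm]
  have hsupp {S : Type _} [CommRing S] (p q r s : S) (k l : Fin (a + b))
      (h : planeMatrix i j p q r s k l ≠ 0) : (k : ℕ) < a ↔ (l : ℕ) < a := by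
    simp only [planeMatrix, Matrix.of_apply] at h
    split_ifs at h <;> simp only [Pi.add_apply, Pi.single_apply] at h <;> grind
  refine ⟨?_, planeMatrix i j (X ^ 2 - 1) (2 * X - X ^ 3) X (-(X ^ 2 - 1)), ?_, ?_, ?_, ?_⟩
  · rw [hT]
    refine Theta_eq_self σ a b _ (fun k l => ?_) (hsupp _ _ _ _)
    rw [← Matrix.map_apply (f := σ), planeMatrix_map]
    simp
  · refine Theta_eq_self _ a b _ (fun k l => ?_) (hsupp _ _ _ _)
    rw [← Matrix.map_apply (f := Polynomial.mapRingHom σ), planeMatrix_map]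
    simp
  · exact IsUnit.of_mul_eq_one _ (planeMatrix_mul_self hij (by ring))
  · rw [planeMatrix_map]
    ext k l
    simp only [planeMatrix, Matrix.of_apply, Matrix.diagonal_apply]
    split_ifs <;> simp_all [eq_comm]
  · rw [planeMatrix_map, hT]
    congr 1 <;> simp
    norm_num
end

section
/- Let R be a commutative ring, let a and b be natural numbers with n = a + b, and let N be an n × n matrix over R such that N_{ij} = 0 whenever the indices i and j lie in the same block. Then: (1) if R is nontrivial and N is invertible, then a = b; (2) if a = b ≥ 1, then the determinant of the (n−1) × (n−1) matrix obtained from N by deleting its first row and its first column equals 0. -/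
open Matrix

/-- If every entry of `M` whose indices agree on `p` vanishes, and `p` does not split the index
type into halves, then `M` has determinant zero. -/
theorem Matrix.det_eq_zero_of_card_filter_ne {R n : Type*} [CommRing R] [Fintype n]
    [DecidableEq n] (p : n → Prop) [DecidablePred p] (M : Matrix n n R)
    (hM : ∀ i j, (p i ↔ p j) → M i j = 0)
    (hcard : (Finset.univ.filter p).card ≠ (Finset.univ.filter fun i => ¬ p i).card) :
    M.det = 0 := by
  rw [det_apply]
  refine Finset.sum_eq_zero fun σ _ => ?_
  obtain ⟨i, hi⟩ : ∃ i, p (σ i) ↔ p i := by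
    by_contra! h
    refine hcard (Finset.card_equiv σ fun i => ?_)
    have := h i
    simp only [Finset.mem_filter, Finset.mem_univ, true_and]
    tauto
  have h : ∏ j, M (σ j) j = 0 := Finset.prod_eq_zero (Finset.mem_univ i) (hM _ _ hi)
  rw [h, smul_zero]

theorem Fin.card_filter_val_lt_of_le {n k : ℕ} (h : k ≤ n) :
    (Finset.univ.filter fun i : Fin n => (i : ℕ) < k).card = k := by
  simp [Fin.card_filter_val_lt, h]

theorem Fin.card_filter_not_val_lt_of_le {n k : ℕ} (h : k ≤ n) :
    (Finset.univ.filter fun i : Fin n => ¬ (i : ℕ) < k).card = n - k := by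
  have := Finset.card_filter_add_card_filter_not (s := Finset.univ) fun i : Fin n => (i : ℕ) < k
  rw [Fin.card_filter_val_lt_of_le h, Finset.card_univ, Fintype.card_fin] at this
  omega

/-- Let `N` be an `(a+b) × (a+b)` matrix whose entries vanish whenever the two indices lie
in the same block (i.e. the diagonal blocks of `N = [A B; C D]` vanish).  Then:
(1) if `R` is nontrivial and `N` is invertible, then `a = b`;
(2) if `a = b ≥ 1`, then the determinant of the matrix obtained from `N` by deleting the
first row and the first column is zero. -/
theorem stmt4 (R : Type*) [CommRing R] (a b : ℕ)
    (N : Matrix (Fin (a + b)) (Fin (a + b)) R)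
    (hN : ∀ i j : Fin (a + b), ((i : ℕ) < a ↔ (j : ℕ) < a) → N i j = 0) :
    (Nontrivial R → IsUnit N → a = b) ∧
    (a = b → 1 ≤ a →
      (N.submatrix
        (fun k : Fin (a + b - 1) => (⟨(k : ℕ) + 1, by have := k.isLt; omega⟩ : Fin (a + b)))
        (fun k : Fin (a + b - 1) =>
          (⟨(k : ℕ) + 1, by have := k.isLt; omega⟩ : Fin (a + b)))).det = 0) := by
  refine ⟨fun _ hu => ?_, fun hab ha => ?_⟩
  · by_contra hne
    refine ((isUnit_iff_isUnit_det N).mp hu).ne_zero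
      (det_eq_zero_of_card_filter_ne (fun i : Fin (a + b) => (i : ℕ) < a) N hN ?_)
    rw [Fin.card_filter_val_lt_of_le (by omega), Fin.card_filter_not_val_lt_of_le (by omega)]
    omega
  · refine det_eq_zero_of_card_filter_ne (fun i : Fin (a + b - 1) => (i : ℕ) < a - 1) _
      (fun i j hij => hN _ _ ?_) ?_
    · dsimp only at hij ⊢
      omega
    · rw [Fin.card_filter_val_lt_of_le (by omega), Fin.card_filter_not_val_lt_of_le (by omega)]
      omega
end

section
/- Let R be a commutative local ring with a ring involution σ and let n = a + b ≥ 1. Call two n × n matrices M₀ and M₁ over R elementarily homotopic if there exists a Θ-invariant n × n matrix P over R[t] such that P(r) is invertible for every r ∈ R, P(0) = M₀ and P(1) = M₁; call M₀ and M₁ A¹-homotopic if they are related by the equivalence relation generated by elementary homotopy. Then every Θ-invariant invertible n × n matrix M over R is A¹-homotopic to a block diagonal matrix of one of the following two forms: either (requiring a ≥ 1) the block diagonal matrix diag(u, M′) with u a σ-invariant unit of R and M′ an invertible (n−1) × (n−1) matrix invariant under the involution defined in the same way for block sizes (a − 1, b); or (requiring b ≥ 1) the block diagonal matrix diag(M′,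 u) with u a σ-invariant unit of R and M′ an invertible (n−1) × (n−1) matrix invariant under the involution defined in the same way for block sizes (a, b − 1). -/
open Matrix Polynomial

/-- `M₀` and `M₁` are elementarily homotopic if there is a `Θ`-invariant matrix `P` over
`R[t]` with `P(r)` invertible for every `r ∈ R`, `P(0) = M₀` and `P(1) = M₁`. -/
def ElemHomotopic {R : Type*} [CommRing R] (σ : R →+* R) (a b : ℕ)
    (M₀ M₁ : Matrix (Fin (a + b)) (Fin (a + b)) R) : Prop :=
  ∃ P : Matrix (Fin (a + b)) (Fin (a + b)) (Polynomial R),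
    Theta (Polynomial.mapRingHom σ) a b P = P ∧
    (∀ r : R, IsUnit (P.map (Polynomial.evalRingHom r))) ∧
    P.map (Polynomial.evalRingHom (0 : R)) = M₀ ∧
    P.map (Polynomial.evalRingHom (1 : R)) = M₁

/-- `A¹`-homotopy: the equivalence relation generated by elementary homotopy. -/
def A1Homotopic {R : Type*} [CommRing R] (σ : R →+* R) (a b : ℕ)
    (M₀ M₁ : Matrix (Fin (a + b)) (Fin (a + b)) R) : Prop :=
  Relation.EqvGen (ElemHomotopic σ a b) M₀ M₁

section ThetaInvariant

variable {R : Type*} [CommRing R] {a b : ℕ}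

/-- The diagonal entries of `blockJ`. -/
def blockSign (R : Type*) [CommRing R] (a b : ℕ) (i : Fin (a + b)) : R :=
  if (i : ℕ) < a then 1 else -1

theorem blockSign_mul_self (i : Fin (a + b)) : blockSign R a b i * blockSign R a b i = 1 := by
  unfold blockSign; split_ifs <;> simp

theorem map_blockSign {S : Type*} [CommRing S] (f : R →+* S) (i : Fin (a + b)) :
    f (blockSign R a b i) = blockSign S a b i := by
  unfold blockSign; split_ifs <;> simp

theorem Theta_apply_s6 (σ : R →+* R) (M : Matrix (Fin (a + b)) (Fin (a + b)) R)
    (i j : Fin (a + b)) :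
    Theta σ a b M i j = blockSign R a b i * σ (M i j) * blockSign R a b j := by
  simp [Theta, blockJ, blockSign, Matrix.diagonal_mul, Matrix.mul_diagonal]

theorem Theta_eq_self_iff (σ : R →+* R) (M : Matrix (Fin (a + b)) (Fin (a + b)) R) :
    Theta σ a b M = M ↔
      ∀ i j, σ (M i j) = blockSign R a b i * blockSign R a b j * M i j := by
  rw [← Matrix.ext_iff]
  refine forall₂_congr fun i j => ?_
  rw [Theta_apply_s6]
  have hi := blockSign_mul_self (R := R) i
  have hj := blockSign_mul_self (R := R) j
  constructor <;> intro h
  · linear_combination (blockSign R a b i * blockSign R a b j) * h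
      - (σ (M i j) * blockSign R a b j * blockSign R a b j) * hi - σ (M i j) * hj
  · rw [h]
    linear_combination (M i j * blockSign R a b j * blockSign R a b j) * hi + M i j * hj

theorem Theta_mul (σ : R →+* R) (M N : Matrix (Fin (a + b)) (Fin (a + b)) R) :
    Theta σ a b (M * N) = Theta σ a b M * Theta σ a b N := by
  have hJ : blockJ R a b * blockJ R a b = 1 := by
    rw [blockJ, Matrix.diagonal_mul_diagonal, ← Matrix.diagonal_one]
    congr 1
    funext i
    exact blockSign_mul_self i
  simp only [Theta, Matrix.map_mul]
  calc _ = blockJ R a b * M.map σ * 1 * N.map σ * blockJ R a b := by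
        simp only [Matrix.mul_one, Matrix.mul_assoc]
    _ = _ := by rw [← hJ]; simp only [Matrix.mul_assoc]

theorem Theta_add (σ : R →+* R) (M N : Matrix (Fin (a + b)) (Fin (a + b)) R) :
    Theta σ a b (M + N) = Theta σ a b M + Theta σ a b N := by
  ext i j
  simp only [Theta_apply_s6, Matrix.add_apply, map_add]
  ring

theorem Theta_one (σ : R →+* R) : Theta σ a b 1 = 1 := by
  rw [Theta_eq_self_iff]
  intro i j
  by_cases h : i = j
  · subst h; simp [blockSign_mul_self]
  · simp [Matrix.one_apply_ne h]

theorem Theta_mapRingHom_map_C (σ : R →+* R) (M : Matrix (Fin (a + b)) (Fin (a + b)) R) :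
    Theta (Polynomial.mapRingHom σ) a b (M.map C) = (Theta σ a b M).map C := by
  ext1 i j
  simp [Theta_apply_s6, map_blockSign (C : R →+* R[X])]

theorem Theta_mapRingHom_X_smul (σ : R →+* R)
    (P : Matrix (Fin (a + b)) (Fin (a + b)) R[X]) :
    Theta (Polynomial.mapRingHom σ) a b ((X : R[X]) • P)
      = (X : R[X]) • Theta (Polynomial.mapRingHom σ) a b P := by
  ext1 i j
  simp only [Theta_apply_s6, Matrix.smul_apply, smul_eq_mul, map_mul, coe_mapRingHom, map_X]
  ring

theorem isUnit_one_add_of_mul_self_eq_zero {A : Type*} [Ring A] {x : A} (hx : x * x = 0) :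
    IsUnit (1 + x) :=
  IsNilpotent.isUnit_one_add ⟨2, by rw [pow_two, hx]⟩

theorem map_eval_one_add_X_smul (N : Matrix (Fin (a + b)) (Fin (a + b)) R) (r : R) :
    (1 + (X : R[X]) • N.map C).map (Polynomial.evalRingHom r) = 1 + r • N := by
  ext i j
  by_cases h : i = j
  · subst h; simp [mul_comm (N i i)]
  · simp [Matrix.one_apply_ne h, mul_comm (N i j)]

theorem map_C_map_eval (M : Matrix (Fin (a + b)) (Fin (a + b)) R) (r : R) :
    (M.map C).map (Polynomial.evalRingHom r) = M := by
  ext i j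
  simp

/-- `N` is a `Θ`-invariant invertible matrix that is `A¹`-homotopic to `M`. -/
structure InvariantHomotopic (σ : R →+* R) (a b : ℕ)
    (M N : Matrix (Fin (a + b)) (Fin (a + b)) R) : Prop where
  homotopic : A1Homotopic σ a b M N
  invariant : Theta σ a b N = N
  isUnit : IsUnit N

theorem InvariantHomotopic.trans {σ : R →+* R} {M N K : Matrix (Fin (a + b)) (Fin (a + b)) R}
    (h : InvariantHomotopic σ a b M N) (h' : InvariantHomotopic σ a b N K) :
    InvariantHomotopic σ a b M K :=
  ⟨h.homotopic.trans _ _ _ h'.homotopic, h'.invariant, h'.isUnit⟩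

/-- Left and right multiplication by unipotent `Θ`-invariant matrices `1 + L` and `1 + N`. -/
theorem InvariantHomotopic.mul_mul {σ : R →+* R}
    {M L N : Matrix (Fin (a + b)) (Fin (a + b)) R}
    (hM : Theta σ a b M = M) (hMu : IsUnit M)
    (hL : Theta σ a b L = L) (hL2 : L * L = 0) (hN : Theta σ a b N = N) (hN2 : N * N = 0) :
    InvariantHomotopic σ a b M ((1 + L) * M * (1 + N)) where
  homotopic := by
    refine Relation.EqvGen.rel _ _
      ⟨(1 + (X : R[X]) • L.map C) * M.map C * (1 + (X : R[X]) • N.map C), ?_, fun r => ?_, ?_, ?_⟩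
    · simp only [Theta_mul, Theta_add, Theta_one, Theta_mapRingHom_X_smul,
        Theta_mapRingHom_map_C, hM, hL, hN]
    all_goals rw [Matrix.map_mul, Matrix.map_mul, map_eval_one_add_X_smul,
      map_eval_one_add_X_smul, map_C_map_eval]
    · refine ((isUnit_one_add_of_mul_self_eq_zero ?_).mul hMu).mul
        (isUnit_one_add_of_mul_self_eq_zero ?_) <;> simp [hL2, hN2]
    all_goals simp
  invariant := by simp only [Theta_mul, Theta_add, Theta_one, hM, hL, hN]
  isUnit := ((isUnit_one_add_of_mul_self_eq_zero hL2).mul hMu).mul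
    (isUnit_one_add_of_mul_self_eq_zero hN2)

theorem InvariantHomotopic.refl {σ : R →+* R} {M : Matrix (Fin (a + b)) (Fin (a + b)) R}
    (hM : Theta σ a b M = M) (hMu : IsUnit M) : InvariantHomotopic σ a b M M :=
  ⟨Relation.EqvGen.refl _, hM, hMu⟩

theorem Theta_zero (σ : R →+* R) : Theta σ a b 0 = 0 := by
  rw [Theta_eq_self_iff]; simp

theorem Theta_single {σ : R →+* R} {i j : Fin (a + b)} {c : R}
    (hc : σ c = blockSign R a b i * blockSign R a b j * c) :
    Theta σ a b (Matrix.single i j c) = Matrix.single i j c := by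
  rw [Theta_eq_self_iff]
  intro k l
  by_cases h : i = k ∧ j = l
  · obtain ⟨rfl, rfl⟩ := h
    simpa using hc
  · simp [Matrix.single_apply_of_ne _ _ _ _ _ h]

theorem InvariantHomotopic.addRow {σ : R →+* R} {M : Matrix (Fin (a + b)) (Fin (a + b)) R}
    (hM : Theta σ a b M = M) (hMu : IsUnit M) {i j : Fin (a + b)} (hij : i ≠ j) {c : R}
    (hc : σ c = blockSign R a b i * blockSign R a b j * c) :
    ∃ K, InvariantHomotopic σ a b M K ∧ ∀ k, K i k = M i k + c * M j k := by
  refine ⟨_, mul_mul hM hMu (Theta_single hc) (by simp [hij.symm]) (Theta_zero σ) (by simp), ?_⟩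
  intro k
  simp [Matrix.add_mul]

theorem InvariantHomotopic.addCol {σ : R →+* R} {M : Matrix (Fin (a + b)) (Fin (a + b)) R}
    (hM : Theta σ a b M = M) (hMu : IsUnit M) {i j : Fin (a + b)} (hij : i ≠ j) {c : R}
    (hc : σ c = blockSign R a b i * blockSign R a b j * c) :
    ∃ K, InvariantHomotopic σ a b M K ∧ ∀ k, K k j = M k j + M k i * c := by
  refine ⟨_, mul_mul hM hMu (Theta_zero σ) (by simp) (Theta_single hc) (by simp [hij.symm]), ?_⟩
  intro k
  simp [Matrix.mul_add]

/-- Clearing the row and the column of an invertible diagonal entry. -/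
theorem exists_invariantHomotopic_clear {σ : R →+* R}
    {M : Matrix (Fin (a + b)) (Fin (a + b)) R} (hM : Theta σ a b M = M) (hMu : IsUnit M)
    {p : Fin (a + b)} (hp : IsUnit (M p p)) :
    ∃ K, InvariantHomotopic σ a b M K ∧ K p p = M p p ∧
      ∀ i, i ≠ p → K i p = 0 ∧ K p i = 0 := by
  obtain ⟨v, hv⟩ := hp.exists_right_inv
  have hM' := (Theta_eq_self_iff σ M).1 hM
  have hσp : σ (M p p) = M p p := by rw [hM', blockSign_mul_self, one_mul]
  have hσv : σ v = v := by
    have h1 : M p p * σ v = 1 := by rw [← hσp, ← map_mul, hv, map_one]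
    linear_combination v * h1 - σ v * hv
  set L : Matrix (Fin (a + b)) (Fin (a + b)) R :=
    Matrix.of fun i j => if i ≠ p ∧ j = p then -(M i p * v) else 0 with hL
  set N : Matrix (Fin (a + b)) (Fin (a + b)) R :=
    Matrix.of fun i j => if i = p ∧ j ≠ p then -(v * M p j) else 0 with hN
  have hLT : Theta σ a b L = L := by
    rw [Theta_eq_self_iff]
    intro i j
    by_cases h : i ≠ p ∧ j = p
    · have hLp : L i p = -(M i p * v) := by simp [hL, h.1]
      rw [h.2, hLp, map_neg, map_mul, hσv, hM' i p]
      ring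
    · simp [hL, if_neg h]
  have hNT : Theta σ a b N = N := by
    rw [Theta_eq_self_iff]
    intro i j
    by_cases h : i = p ∧ j ≠ p
    · have hNp : N p j = -(v * M p j) := by simp [hN, h.2]
      rw [h.1, hNp, map_neg, map_mul, hσv, hM' p j]
      ring
    · simp [hN, if_neg h]
  have hL2 : L * L = 0 := by
    ext i j
    rw [Matrix.mul_apply]
    refine Finset.sum_eq_zero fun k _ => ?_
    by_cases hk : k = p <;> simp [hL, hk]
  have hN2 : N * N = 0 := by
    ext i j
    rw [Matrix.mul_apply]
    refine Finset.sum_eq_zero fun k _ => ?_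
    by_cases hk : k = p <;> simp [hN, hk]
  have hLM : ∀ i j, ((1 + L) * M) i j
      = M i j + if i = p then 0 else -(M i p * v) * M p j := by
    intro i j
    rw [Matrix.add_mul, Matrix.one_mul, Matrix.add_apply, Matrix.mul_apply,
      Finset.sum_eq_single p]
    · by_cases hi : i = p <;> simp [hL, hi]
    · intro k _ hk
      simp [hL, hk]
    · simp
  have hK : ∀ i j, ((1 + L) * M * (1 + N)) i j
      = ((1 + L) * M) i j + if j = p then 0 else ((1 + L) * M) i p * -(v * M p j) := by
    intro i j
    rw [Matrix.mul_add, Matrix.mul_one, Matrix.add_apply, Matrix.mul_apply (N := N),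
      Finset.sum_eq_single p]
    · by_cases hj : j = p <;> simp [hN, hj]
    · intro k _ hk
      simp [hN, hk]
    · simp
  refine ⟨_, .mul_mul hM hMu hLT hL2 hNT hN2, by simp [hK, hLM], fun i hi => ⟨?_, ?_⟩⟩
  · simp only [hK, hLM, if_true, if_neg hi]
    linear_combination -(M i p) * hv
  · simp only [hK, hLM, if_true, if_neg hi]
    linear_combination -(M p i) * hv

end ThetaInvariant

section LocalRing

variable {R : Type*} [CommRing R] [IsLocalRing R]

theorem IsLocalRing.isUnit_add_of_not_isUnit {x y : R} (hx : ¬IsUnit x) (hy : IsUnit y) :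
    IsUnit (x + y) := by
  by_contra h
  refine IsLocalRing.nonunits_add (a := x + y) (b := -x) h ?_ (by simpa using hy)
  simpa [mem_nonunits_iff] using hx

theorem Matrix.exists_isUnit_apply_of_isUnit {n : Type*} [Fintype n] [DecidableEq n]
    {M : Matrix n n R} (hM : IsUnit M) (i : n) : ∃ j, IsUnit (M i j) := by
  by_contra! h
  obtain ⟨N, hN⟩ := hM.exists_right_inv
  have h1 : (1 : R) ∈ IsLocalRing.maximalIdeal R := by
    rw [← Matrix.one_apply_eq (n := n) i, ← hN, Matrix.mul_apply]
    exact Ideal.sum_mem _ fun j _ => Ideal.mul_mem_right _ _ (h j)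
  exact (IsLocalRing.mem_maximalIdeal _).1 h1 isUnit_one

variable {a b : ℕ}

theorem exists_invariantHomotopic_isUnit_apply {σ : R →+* R} (hn : 1 ≤ a + b)
    {M : Matrix (Fin (a + b)) (Fin (a + b)) R} (hM : Theta σ a b M = M) (hMu : IsUnit M) :
    ∃ K, InvariantHomotopic σ a b M K ∧
      ∃ i j : Fin (a + b), ((i : ℕ) < a ↔ (j : ℕ) < a) ∧ IsUnit (K i j) := by
  by_cases h : ∃ i j : Fin (a + b), ((i : ℕ) < a ↔ (j : ℕ) < a) ∧ IsUnit (M i j)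
  · exact ⟨M, .refl hM hMu, h⟩
  push Not at h
  obtain ⟨j, hj⟩ := Matrix.exists_isUnit_apply_of_isUnit hMu ⟨0, hn⟩
  obtain ⟨k, hk⟩ := Matrix.exists_isUnit_apply_of_isUnit hMu j
  have hij : ¬((0 < a) ↔ (j : ℕ) < a) := fun h' => h ⟨0, hn⟩ j h' hj
  have hjk : ¬((j : ℕ) < a ↔ (k : ℕ) < a) := fun h' => h j k h' hk
  have hik : 0 < a ↔ (k : ℕ) < a := by tauto
  have hne : (⟨0, hn⟩ : Fin (a + b)) ≠ j := by
    rintro rfl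
    exact hij Iff.rfl
  obtain ⟨K, hK, hK'⟩ := InvariantHomotopic.addRow hM hMu hne
    ((Theta_eq_self_iff σ M).1 hM _ _)
  refine ⟨K, hK, ⟨0, hn⟩, k, hik, ?_⟩
  rw [hK']
  exact IsLocalRing.isUnit_add_of_not_isUnit (h ⟨0, hn⟩ k hik) (hj.mul hk)

theorem exists_invariantHomotopic_isUnit_diag {σ : R →+* R}
    {M : Matrix (Fin (a + b)) (Fin (a + b)) R} (hM : Theta σ a b M = M) (hMu : IsUnit M)
    {i j p : Fin (a + b)} (hi : (i : ℕ) < a ↔ (p : ℕ) < a) (hj : (j : ℕ) < a ↔ (p : ℕ) < a)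
    (hij : IsUnit (M i j)) :
    ∃ K, InvariantHomotopic σ a b M K ∧ IsUnit (K p p) := by
  have hs : ∀ k : Fin (a + b), ((k : ℕ) < a ↔ (p : ℕ) < a) →
      blockSign R a b k = blockSign R a b p := fun k hk => by simp [blockSign, hk]
  have hrow : ∃ K, InvariantHomotopic σ a b M K ∧ IsUnit (K p j) := by
    by_cases hpj : IsUnit (M p j)
    · exact ⟨M, .refl hM hMu, hpj⟩
    have hne : p ≠ i := by
      rintro rfl
      exact hpj hij
    obtain ⟨K, hK, hK'⟩ := InvariantHomotopic.addRow hM hMu hne (c := 1)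
      (by simp [hs i hi, blockSign_mul_self])
    refine ⟨K, hK, ?_⟩
    rw [hK', one_mul]
    exact IsLocalRing.isUnit_add_of_not_isUnit hpj hij
  obtain ⟨K, hK, hKu⟩ := hrow
  by_cases hpp : IsUnit (K p p)
  · exact ⟨K, hK, hpp⟩
  have hne : j ≠ p := by
    rintro rfl
    exact hpp hKu
  obtain ⟨K', hK', hK''⟩ := InvariantHomotopic.addCol hK.invariant hK.isUnit hne (c := 1)
    (by simp [hs j hj, blockSign_mul_self])
  refine ⟨K', hK.trans hK', ?_⟩
  rw [hK'', mul_one]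
  exact IsLocalRing.isUnit_add_of_not_isUnit hpp hKu

theorem exists_invariantHomotopic_split {σ : R →+* R}
    {M : Matrix (Fin (a + b)) (Fin (a + b)) R} (hM : Theta σ a b M = M) (hMu : IsUnit M)
    {i j p : Fin (a + b)} (hi : (i : ℕ) < a ↔ (p : ℕ) < a) (hj : (j : ℕ) < a ↔ (p : ℕ) < a)
    (hij : IsUnit (M i j)) :
    ∃ K, InvariantHomotopic σ a b M K ∧ IsUnit (K p p) ∧
      ∀ i, i ≠ p → K i p = 0 ∧ K p i = 0 := by
  obtain ⟨K, hK, hKu⟩ := exists_invariantHomotopic_isUnit_diag hM hMu hi hj hij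
  obtain ⟨K', hK', hp, h0⟩ := exists_invariantHomotopic_clear hK.invariant hK.isUnit hKu
  exact ⟨K', hK.trans hK', hp ▸ hKu, h0⟩

end LocalRing

theorem Theta_submatrix_eq_self {R : Type*} [CommRing R] {σ : R →+* R} {a b c d : ℕ}
    {K : Matrix (Fin (a + b)) (Fin (a + b)) R} (hK : Theta σ a b K = K)
    (f : Fin (c + d) → Fin (a + b)) (hf : ∀ i, ((f i : ℕ) < a ↔ (i : ℕ) < c)) :
    Theta σ c d (K.submatrix f f) = K.submatrix f f := by
  rw [Theta_eq_self_iff] at hK ⊢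
  intro i j
  simp [hK (f i) (f j), blockSign, hf]

/-- Over a commutative local ring, every `Θ`-invariant invertible matrix is `A¹`-homotopic
to a block diagonal matrix `diag(u, M′)` (if `a ≥ 1`) or `diag(M′, u)` (if `b ≥ 1`), where
`u` is a `σ`-invariant unit and `M′` is an invertible `(n-1) × (n-1)` matrix invariant
under the involution for the corresponding smaller block sizes. -/
theorem stmt6 {R : Type*} [CommRing R] [IsLocalRing R]
    (σ : R →+* R) (hσ : Function.Involutive σ)
    (a b : ℕ) (hn : 1 ≤ a + b)
    (M : Matrix (Fin (a + b)) (Fin (a + b)) R)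
    (hM : Theta σ a b M = M) (hMu : IsUnit M) :
    ∃ N : Matrix (Fin (a + b)) (Fin (a + b)) R,
      A1Homotopic σ a b M N ∧
      ((∃ (ha : 1 ≤ a) (u : R) (M' : Matrix (Fin (a - 1 + b)) (Fin (a - 1 + b)) R),
          IsUnit u ∧ σ u = u ∧ IsUnit M' ∧ Theta σ (a - 1) b M' = M' ∧
          N = Matrix.submatrix
            (Matrix.fromBlocks (Matrix.of fun (_ : Fin 1) (_ : Fin 1) => u) 0 0 M')
            (fun i => finSumFinEquiv.symm (Fin.cast (by omega) i))
            (fun i => finSumFinEquiv.symm (Fin.cast (by omega) i))) ∨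
       (∃ (hb : 1 ≤ b) (u : R) (M' : Matrix (Fin (a + (b - 1))) (Fin (a + (b - 1))) R),
          IsUnit u ∧ σ u = u ∧ IsUnit M' ∧ Theta σ a (b - 1) M' = M' ∧
          N = Matrix.submatrix
            (Matrix.fromBlocks M' 0 0 (Matrix.of fun (_ : Fin 1) (_ : Fin 1) => u))
            (fun i => finSumFinEquiv.symm (Fin.cast (by omega) i))
            (fun i => finSumFinEquiv.symm (Fin.cast (by omega) i)))) := by
  obtain ⟨M₁, hM₁, i, j, hij, hu⟩ := exists_invariantHomotopic_isUnit_apply hn hM hMu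
  by_cases hi : (i : ℕ) < a
  · have ha : 1 ≤ a := by omega
    let e : Fin (a + b) ≃ Fin 1 ⊕ Fin (a - 1 + b) :=
      (finCongr (by omega)).trans finSumFinEquiv.symm
    have hp : (e.symm (Sum.inl 0) : ℕ) < a := by simp [e]; omega
    obtain ⟨K, hK, hKu, h0⟩ := exists_invariantHomotopic_split hM₁.invariant hM₁.isUnit
      (p := e.symm (Sum.inl 0)) (by tauto) (by tauto) hu
    have hKe : K = (Matrix.fromBlocks
        (Matrix.of fun (_ : Fin 1) (_ : Fin 1) => K (e.symm (Sum.inl 0)) (e.symm (Sum.inl 0)))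
        0 0 (K.submatrix (e.symm ∘ Sum.inr) (e.symm ∘ Sum.inr))).submatrix e e := by
      rw [← Matrix.submatrix_id_id K, ← e.symm_comp_self, ← Matrix.submatrix_submatrix]
      congr 1
      ext (x | x) (y | y)
      · simp [Subsingleton.elim x 0, Subsingleton.elim y 0]
      · simp [Subsingleton.elim x 0, (h0 (e.symm (Sum.inr y)) (by simp)).2]
      · simp [Subsingleton.elim y 0, (h0 (e.symm (Sum.inr x)) (by simp)).1]
      · simp
    refine ⟨K, (hM₁.trans hK).homotopic, Or.inl ⟨ha, K (e.symm (Sum.inl 0)) (e.symm (Sum.inl 0)),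
      K.submatrix (e.symm ∘ Sum.inr) (e.symm ∘ Sum.inr), hKu, ?_, ?_, ?_, hKe⟩⟩
    · rw [(Theta_eq_self_iff σ K).1 hK.invariant, blockSign_mul_self, one_mul]
    · have h := hK.isUnit
      rw [hKe, Matrix.isUnit_submatrix_equiv, Matrix.isUnit_iff_isUnit_det,
        Matrix.det_fromBlocks_zero₂₁] at h
      exact (Matrix.isUnit_iff_isUnit_det _).2 (isUnit_of_mul_isUnit_right h)
    · refine Theta_submatrix_eq_self hK.invariant _ fun k => ?_
      simp [e]
      omega
  · have hb : 1 ≤ b := by omega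
    let e : Fin (a + b) ≃ Fin (a + (b - 1)) ⊕ Fin 1 :=
      (finCongr (by omega)).trans finSumFinEquiv.symm
    have hp : ¬(e.symm (Sum.inr 0) : ℕ) < a := by simp [e]
    obtain ⟨K, hK, hKu, h0⟩ := exists_invariantHomotopic_split hM₁.invariant hM₁.isUnit
      (p := e.symm (Sum.inr 0)) (by tauto) (by tauto) hu
    have hKe : K = (Matrix.fromBlocks (K.submatrix (e.symm ∘ Sum.inl) (e.symm ∘ Sum.inl)) 0 0
        (Matrix.of fun (_ : Fin 1) (_ : Fin 1) =>
          K (e.symm (Sum.inr 0)) (e.symm (Sum.inr 0)))).submatrix e e := by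
      rw [← Matrix.submatrix_id_id K, ← e.symm_comp_self, ← Matrix.submatrix_submatrix]
      congr 1
      ext (x | x) (y | y)
      · simp
      · simp [Subsingleton.elim y 0, (h0 (e.symm (Sum.inl x)) (by simp)).1]
      · simp [Subsingleton.elim x 0, (h0 (e.symm (Sum.inl y)) (by simp)).2]
      · simp [Subsingleton.elim x 0, Subsingleton.elim y 0]
    refine ⟨K, (hM₁.trans hK).homotopic, Or.inr ⟨hb, K (e.symm (Sum.inr 0)) (e.symm (Sum.inr 0)),
      K.submatrix (e.symm ∘ Sum.inl) (e.symm ∘ Sum.inl), hKu, ?_, ?_, ?_, hKe⟩⟩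
    · rw [(Theta_eq_self_iff σ K).1 hK.invariant, blockSign_mul_self, one_mul]
    · have h := hK.isUnit
      rw [hKe, Matrix.isUnit_submatrix_equiv, Matrix.isUnit_iff_isUnit_det,
        Matrix.det_fromBlocks_zero₂₁] at h
      exact (Matrix.isUnit_iff_isUnit_det _).2 (isUnit_of_mul_isUnit_left h)
    · refine Theta_submatrix_eq_self hK.invariant _ fun k => ?_
      simp [e]
end

section
/- Let X be a separated scheme, G a finite group, and ρ : G → Aut(X) an action of G on X by scheme automorphisms. Then every point x of X admits an affine open neighborhood U such that for every g ∈ G whose induced automorphism of the underlying topological space fixes x, the image of U under ρ(g) equals U. In other words, every point of X has an affine open neighborhood invariant under its set-theoretic stabilizer. -/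
open AlgebraicGeometry CategoryTheory

/-- The action on points of a scheme induced by a homomorphism to its automorphism group
is compatible with multiplication. -/
lemma AlgebraicGeometry.Scheme.aut_mul_apply {X : AlgebraicGeometry.Scheme} {G : Type*} [Group G]
    (ρ : G →* Aut X) (g h : G) (y : X) :
    (ρ (g * h)).hom.base y = (ρ g).hom.base ((ρ h).hom.base y) := by
  rw [map_mul, Aut.Aut_mul_def]
  exact Scheme.Hom.comp_apply (ρ h).hom (ρ g).hom y

/-- The identity element acts trivially on points. -/
lemma AlgebraicGeometry.Scheme.aut_one_apply {X : AlgebraicGeometry.Scheme} {G : Type*} [Group G]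
    (ρ : G →* Aut X) (y : X) : (ρ 1).hom.base y = y := by
  rw [map_one]
  rfl

/-- Every point of a separated scheme with an action of a finite group `G` by scheme
automorphisms admits an affine open neighborhood invariant under its set-theoretic
stabilizer. -/
theorem stmt7 (X : AlgebraicGeometry.Scheme) [X.IsSeparated]
    (G : Type*) [Group G] [Finite G] (ρ : G →* Aut X) (x : X) :
    ∃ U : X.Opens, IsAffineOpen U ∧ x ∈ U ∧
      ∀ g : G, (ρ g).hom.base x = x →
        (ρ g).hom.base '' (U : Set X) = (U : Set X) := by
  obtain ⟨V, hV, hxV, -⟩ := exists_isAffineOpen_mem_and_subset (x := x) (U := ⊤) trivial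
  let S := {g : G // (ρ g).hom.base x = x}
  have : Nonempty S := ⟨⟨1, Scheme.aut_one_apply ρ x⟩⟩
  let U : X.Opens := ⨅ g : S, (ρ g.1).hom ⁻¹ᵁ V
  have mem_U (y : X) : y ∈ U ↔ ∀ g : G, (ρ g).hom.base x = x → (ρ g).hom.base y ∈ V := by
    rw [← SetLike.mem_coe, TopologicalSpace.Opens.coe_iInf]
    simp only [Set.mem_iInter]
    exact ⟨fun h g hg ↦ h ⟨g, hg⟩, fun h g ↦ h g.1 g.2⟩
  have map_U (h : G) (hh : (ρ h).hom.base x = x) (y : X) (hy : y ∈ U) :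
      (ρ h).hom.base y ∈ U := by
    rw [mem_U] at hy ⊢
    intro g hg
    rw [← Scheme.aut_mul_apply]
    exact hy (g * h) (by rw [Scheme.aut_mul_apply, hh, hg])
  have hU : IsAffineOpen U := .iInf fun g ↦
    haveI : IsIso (ρ g.1).hom := Iso.isIso_hom (ρ g.1)
    hV.preimage _
  refine ⟨U, hU, (mem_U x).2 fun g hg ↦ by rwa [hg], fun g hg ↦ ?_⟩
  refine (Set.image_subset_iff.2 (map_U g hg)).antisymm fun y hy ↦ ⟨(ρ g⁻¹).hom.base y, ?_, ?_⟩
  · refine map_U _ ?_ y hy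
    conv_lhs => rw [← hg]
    rw [← Scheme.aut_mul_apply, inv_mul_cancel, Scheme.aut_one_apply]
  · rw [← Scheme.aut_mul_apply, mul_inv_cancel, Scheme.aut_one_apply]
end
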